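/- Let H₀ be a skew-symmetric operator. Then the following four statements are equivalent: (i) there exists a skew-self-adjoint extension of H₀; (ii) the deficiency indices of H₀ are equal, i.e. dim ker(1 − H₀*) = dim ker(1 + H₀*) as Hilbert space dimensions; (iii) there exists a boundary triplet for H₀; (iv) there exist complex Hilbert spaces 𝒢₁, 𝒢₂ with dim 𝒢₁ = dim 𝒢₂ and a boundary system (𝒢₁, 𝒢₂, F) for H₀ with the standard symmetric and standard unitary forms. -/

import Mathlib

open scoped InnerProductSpace

section Krein

variable {V G₁ G₂ : Type*} [AddCommGroup V] [Module ℂ V]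
  [NormedAddCommGroup G₁] [InnerProductSpace ℂ G₁] [NormedAddCommGroup G₂] [InnerProductSpace ℂ G₂]

/-- The standard indefinite form on `G₁ × G₂` is nondegenerate. -/
theorem eq_of_forall_inner_sub_inner_eq {p q : G₁ × G₂}
    (h : ∀ r : G₁ × G₂, ⟪p.1, r.1⟫_ℂ - ⟪p.2, r.2⟫_ℂ = ⟪q.1, r.1⟫_ℂ - ⟪q.2, r.2⟫_ℂ) : p = q := by
  refine Prod.ext (ext_inner_right ℂ fun v => ?_) (ext_inner_right ℂ fun v => ?_)
  · simpa using h (v, 0)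
  · simpa using h (0, v)

/-- A surjection intertwining a sesquilinear form with the standard indefinite form is linear. -/
theorem exists_linearMap_of_surjective_of_form (B : V →ₗ⋆[ℂ] V →ₗ[ℂ] ℂ) {F : V → G₁ × G₂}
    (hF : Function.Surjective F)
    (hB : ∀ x y, B x y = ⟪(F x).1, (F y).1⟫_ℂ - ⟪(F x).2, (F y).2⟫_ℂ) :
    ∃ F' : V →ₗ[ℂ] G₁ × G₂, ∀ x, F' x = F x := by
  refine ⟨{ toFun := F, map_add' := fun x y => ?_, map_smul' := fun c x => ?_ }, fun _ => rfl⟩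
  · refine eq_of_forall_inner_sub_inner_eq fun r => ?_
    obtain ⟨z, rfl⟩ := hF r
    rw [← hB, map_add, LinearMap.add_apply, hB, hB]
    simp only [Prod.fst_add, Prod.snd_add, inner_add_left]
    ring
  · refine eq_of_forall_inner_sub_inner_eq fun r => ?_
    obtain ⟨z, rfl⟩ := hF r
    rw [← hB, LinearMap.map_smulₛₗ, LinearMap.smul_apply, hB]
    simp only [RingHom.id_apply, Prod.smul_fst, Prod.smul_snd, inner_smul_left, smul_eq_mul]
    ring

/-- A Lagrangian subspace of `G₁ × G₂` is the graph of a unitary operator. -/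
theorem nonempty_linearIsometryEquiv_of_lagrangian [CompleteSpace G₁] [CompleteSpace G₂]
    (L : Submodule ℂ (G₁ × G₂))
    (hL : ∀ p, p ∈ L ↔ ∀ q ∈ L, ⟪q.1, p.1⟫_ℂ - ⟪q.2, p.2⟫_ℂ = 0) :
    Nonempty (G₁ ≃ₗᵢ[ℂ] G₂) := by
  have hnorm : ∀ p ∈ L, ‖p.1‖ = ‖p.2‖ := fun p hp => by
    have h := (hL p).1 hp p hp
    rw [sub_eq_zero, inner_self_eq_norm_sq_to_K, inner_self_eq_norm_sq_to_K] at h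
    have h' : ‖p.1‖ ^ 2 = ‖p.2‖ ^ 2 := by exact_mod_cast h
    exact (sq_eq_sq₀ (norm_nonneg _) (norm_nonneg _)).1 h'
  have hclosed : IsClosed (L : Set (G₁ × G₂)) := by
    have : (L : Set (G₁ × G₂)) = ⋂ q ∈ L, {p | ⟪q.1, p.1⟫_ℂ - ⟪q.2, p.2⟫_ℂ = 0} := by
      ext p
      simpa using hL p
    rw [this]
    exact isClosed_biInter fun q _ => isClosed_eq (by fun_prop) continuous_const
  have : CompleteSpace L := hclosed.completeSpace_coe
  let P₁ : L →ₗᵢ[ℂ] G₁ :=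
    { toLinearMap := LinearMap.fst ℂ G₁ G₂ ∘ₗ L.subtype
      norm_map' := fun p => by simp [Prod.norm_def, hnorm p p.2] }
  let P₂ : L →ₗᵢ[ℂ] G₂ :=
    { toLinearMap := LinearMap.snd ℂ G₁ G₂ ∘ₗ L.subtype
      norm_map' := fun p => by simp [Prod.norm_def, hnorm p p.2] }
  have hP₁ : Function.Surjective P₁ := by
    suffices h : P₁.toLinearMap.range = ⊤ from LinearMap.range_eq_top.1 h
    have hc : IsClosed (P₁.toLinearMap.range : Set G₁) :=
      P₁.isometry.isClosedEmbedding.isClosed_range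
    have := hc.completeSpace_coe
    rw [← Submodule.orthogonal_eq_bot_iff, Submodule.eq_bot_iff]
    intro a ha
    have hmem : (a, (0 : G₂)) ∈ L := (hL _).2 fun q hq => by
      simpa using ha q.1 ⟨⟨q, hq⟩, rfl⟩
    simpa using hnorm _ hmem
  have hP₂ : Function.Surjective P₂ := by
    suffices h : P₂.toLinearMap.range = ⊤ from LinearMap.range_eq_top.1 h
    have hc : IsClosed (P₂.toLinearMap.range : Set G₂) :=
      P₂.isometry.isClosedEmbedding.isClosed_range
    have := hc.completeSpace_coe
    rw [← Submodule.orthogonal_eq_bot_iff, Submodule.eq_bot_iff]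
    intro a ha
    have hmem : ((0 : G₁), a) ∈ L := (hL _).2 fun q hq => by
      simpa using ha q.2 ⟨⟨q, hq⟩, rfl⟩
    simpa using (hnorm _ hmem).symm
  exact ⟨(LinearIsometryEquiv.ofSurjective P₁ hP₁).symm.trans
    (LinearIsometryEquiv.ofSurjective P₂ hP₂)⟩

/-- A Lagrangian subspace for the pulled back indefinite form yields a unitary operator. -/
theorem nonempty_linearIsometryEquiv_of_form [CompleteSpace G₁] [CompleteSpace G₂]
    (B : V →ₗ⋆[ℂ] V →ₗ[ℂ] ℂ) {F : V → G₁ × G₂} (hF : Function.Surjective F)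
    (hB : ∀ x y, B x y = ⟪(F x).1, (F y).1⟫_ℂ - ⟪(F x).2, (F y).2⟫_ℂ)
    (S : Submodule ℂ V) (hS : ∀ y, y ∈ S ↔ ∀ x ∈ S, B x y = 0) :
    Nonempty (G₁ ≃ₗᵢ[ℂ] G₂) := by
  obtain ⟨F', hF'⟩ := exists_linearMap_of_surjective_of_form B hF hB
  refine nonempty_linearIsometryEquiv_of_lagrangian (S.map F') fun p => ⟨?_, fun h => ?_⟩
  · rintro ⟨y, hy, rfl⟩ _ ⟨x, hx, rfl⟩
    rw [hF', hF', ← hB]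
    exact (hS y).1 hy x hx
  · obtain ⟨y, rfl⟩ := hF p
    refine ⟨y, (hS y).2 fun x hx => ?_, hF' y⟩
    rw [hB, ← hF' x]
    exact h _ ⟨x, hx, rfl⟩

/-- A form which is twice the standard indefinite form comes from a rescaled boundary system. -/
theorem exists_system_of_two_mul {X : Type*} (B : X → X → ℂ) {F : X → G₁ × G₂}
    (hF : Function.Surjective F)
    (hB : ∀ x y, B x y = 2 * ⟪(F x).1, (F y).1⟫_ℂ - 2 * ⟪(F x).2, (F y).2⟫_ℂ) :
    ∃ F' : X → G₁ × G₂, Function.Surjective F' ∧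
      ∀ x y, B x y = ⟪(F' x).1, (F' y).1⟫_ℂ - ⟪(F' x).2, (F' y).2⟫_ℂ := by
  have hc : ((√2 : ℝ) : ℂ) * ((√2 : ℝ) : ℂ) = 2 := by
    rw [← Complex.ofReal_mul, Real.mul_self_sqrt (by norm_num)]
    norm_num
  have hconj : (starRingEnd ℂ) ((√2 : ℝ) : ℂ) = ((√2 : ℝ) : ℂ) := Complex.conj_ofReal _
  have hc0 : ((√2 : ℝ) : ℂ) ≠ 0 := fun h => by simp [h] at hc
  set c : ℂ := ((√2 : ℝ) : ℂ)
  refine ⟨fun x => c • F x, fun p => ?_, fun x y => ?_⟩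
  · obtain ⟨x, hx⟩ := hF (c⁻¹ • p)
    exact ⟨x, by simp only [hx, smul_inv_smul₀ hc0]⟩
  · rw [hB]
    simp only [Prod.smul_fst, Prod.smul_snd, inner_smul_left, inner_smul_right, hconj]
    linear_combination (-⟪(F x).1, (F y).1⟫_ℂ + ⟪(F x).2, (F y).2⟫_ℂ) * hc

theorem invSqrtTwo_mul_self : ((√2 : ℝ) : ℂ)⁻¹ * ((√2 : ℝ) : ℂ)⁻¹ = 1 / 2 := by
  rw [← mul_inv, ← Complex.ofReal_mul, Real.mul_self_sqrt (by norm_num)]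
  norm_num

/-- Rotating a boundary system with unitarily equivalent components gives a boundary triplet. -/
theorem exists_triplet_of_system (B : V →ₗ⋆[ℂ] V →ₗ[ℂ] ℂ) {F : V → G₁ × G₂}
    (hF : Function.Surjective F)
    (hB : ∀ x y, B x y = ⟪(F x).1, (F y).1⟫_ℂ - ⟪(F x).2, (F y).2⟫_ℂ) (U : G₁ ≃ₗᵢ[ℂ] G₂) :
    ∃ Γ₁ Γ₂ : V →ₗ[ℂ] G₁, Function.Surjective (fun x => (Γ₁ x, Γ₂ x)) ∧
      ∀ x y, B x y = ⟪Γ₁ x, Γ₂ y⟫_ℂ + ⟪Γ₂ x, Γ₁ y⟫_ℂ := by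
  obtain ⟨F', hF'⟩ := exists_linearMap_of_surjective_of_form B hF hB
  have hc := invSqrtTwo_mul_self
  have hconj : (starRingEnd ℂ) (((√2 : ℝ) : ℂ)⁻¹) = ((√2 : ℝ) : ℂ)⁻¹ := by
    rw [map_inv₀, Complex.conj_ofReal]
  set c : ℂ := ((√2 : ℝ) : ℂ)⁻¹
  let f₁ : V →ₗ[ℂ] G₁ := LinearMap.fst ℂ G₁ G₂ ∘ₗ F'
  let f₂ : V →ₗ[ℂ] G₁ := U.symm.toLinearEquiv.toLinearMap ∘ₗ LinearMap.snd ℂ G₁ G₂ ∘ₗ F'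
  have h₁ : ∀ x, f₁ x = (F x).1 := fun x => by simp [f₁, hF']
  have h₂ : ∀ x, f₂ x = U.symm (F x).2 := fun x => by simp [f₂, hF']
  refine ⟨c • (f₁ + f₂), c • (f₁ - f₂), ?_, fun x y => ?_⟩
  · rintro ⟨g, h⟩
    obtain ⟨x, hx⟩ := hF (c • (g + h), U (c • (g - h)))
    refine ⟨x, ?_⟩
    simp only [LinearMap.smul_apply, LinearMap.add_apply, LinearMap.sub_apply, h₁, h₂, hx,
      LinearIsometryEquiv.symm_apply_apply, ← smul_add, ← smul_sub, smul_smul, hc, Prod.mk.injEq]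
    constructor <;> module
  · have e₂ : ⟪f₂ x, f₂ y⟫_ℂ = ⟪(F x).2, (F y).2⟫_ℂ := by
      rw [h₂, h₂, LinearIsometryEquiv.inner_map_map]
    rw [hB, ← e₂, ← h₁, ← h₁]
    simp only [LinearMap.smul_apply, LinearMap.add_apply, LinearMap.sub_apply, inner_smul_left,
      inner_smul_right, hconj, inner_add_left, inner_add_right, inner_sub_left, inner_sub_right]
    linear_combination (-2 * (⟪f₁ x, f₁ y⟫_ℂ - ⟪f₂ x, f₂ y⟫_ℂ)) * hc

/-- Rotating a boundary triplet gives a boundary system. -/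
theorem exists_system_of_triplet (B : V →ₗ⋆[ℂ] V →ₗ[ℂ] ℂ) {Γ₁ Γ₂ : V →ₗ[ℂ] G₁}
    (hΓ : Function.Surjective (fun x => (Γ₁ x, Γ₂ x)))
    (hB : ∀ x y, B x y = ⟪Γ₁ x, Γ₂ y⟫_ℂ + ⟪Γ₂ x, Γ₁ y⟫_ℂ) :
    ∃ F : V → G₁ × G₁, Function.Surjective F ∧
      ∀ x y, B x y = ⟪(F x).1, (F y).1⟫_ℂ - ⟪(F x).2, (F y).2⟫_ℂ := by
  have hc := invSqrtTwo_mul_self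
  have hconj : (starRingEnd ℂ) (((√2 : ℝ) : ℂ)⁻¹) = ((√2 : ℝ) : ℂ)⁻¹ := by
    rw [map_inv₀, Complex.conj_ofReal]
  set c : ℂ := ((√2 : ℝ) : ℂ)⁻¹
  refine ⟨fun x => (c • (Γ₁ x + Γ₂ x), c • (Γ₁ x - Γ₂ x)), ?_, fun x y => ?_⟩
  · rintro ⟨g, h⟩
    obtain ⟨x, hx⟩ := hΓ (c • (g + h), c • (g - h))
    simp only [Prod.mk.injEq] at hx
    refine ⟨x, ?_⟩
    simp only [hx.1, hx.2, ← smul_add, ← smul_sub, smul_smul, hc, Prod.mk.injEq]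
    constructor <;> module
  · rw [hB]
    simp only [inner_smul_left, inner_smul_right, hconj, inner_add_left, inner_add_right,
      inner_sub_left, inner_sub_right]
    linear_combination (-2 * (⟪Γ₁ x, Γ₂ y⟫_ℂ + ⟪Γ₂ x, Γ₁ y⟫_ℂ)) * hc

/-- The kernel of a component of a boundary triplet is Lagrangian. -/
theorem mem_ker_iff_of_triplet (B : V →ₗ⋆[ℂ] V →ₗ[ℂ] ℂ) {Γ₁ Γ₂ : V →ₗ[ℂ] G₁}
    (hΓ : Function.Surjective (fun x => (Γ₁ x, Γ₂ x)))
    (hB : ∀ x y, B x y = ⟪Γ₁ x, Γ₂ y⟫_ℂ + ⟪Γ₂ x, Γ₁ y⟫_ℂ) (y : V) :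
    y ∈ Γ₁.ker ↔ ∀ x ∈ Γ₁.ker, B x y = 0 := by
  simp only [LinearMap.mem_ker]
  refine ⟨fun hy x hx => by simp [hB, hx, hy], fun h => ?_⟩
  obtain ⟨x, hx⟩ := hΓ (0, Γ₁ y)
  simp only [Prod.mk.injEq] at hx
  simpa [hB, hx.1, hx.2] using h x hx.1

end Krein

namespace LinearPMap

variable {ℋ : Type*} [NormedAddCommGroup ℋ] [InnerProductSpace ℂ ℋ]

/-- The form `(x, y) ↦ ⟪A x, y⟫ + ⟪x, A y⟫` on the domain of `A`. -/
noncomputable def boundaryForm (A : ℋ →ₗ.[ℂ] ℋ) : A.domain →ₗ⋆[ℂ] A.domain →ₗ[ℂ] ℂ :=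
  LinearMap.mk₂'ₛₗ (starRingEnd ℂ) (RingHom.id ℂ)
    (fun x y => ⟪A x, (y : ℋ)⟫_ℂ + ⟪(x : ℋ), A y⟫_ℂ)
    (fun x y z => by simp only [map_add, Submodule.coe_add, inner_add_left]; ring)
    (fun c x y => by
      simp only [map_smul, Submodule.coe_smul, inner_smul_left, smul_eq_mul]; ring)
    (fun x y z => by simp only [map_add, Submodule.coe_add, inner_add_right]; ring)
    (fun c x y => by
      simp only [map_smul, Submodule.coe_smul, inner_smul_right, smul_eq_mul, RingHom.id_apply]
      ring)

theorem boundaryForm_apply (A : ℋ →ₗ.[ℂ] ℋ) (x y : A.domain) :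
    A.boundaryForm x y = ⟪A x, (y : ℋ)⟫_ℂ + ⟪(x : ℋ), A y⟫_ℂ := rfl

theorem mem_ker_subtype_sub {A : ℋ →ₗ.[ℂ] ℋ} {x : A.domain} :
    x ∈ LinearMap.ker (A.domain.subtype - A.toFun) ↔ A x = x := by
  rw [LinearMap.mem_ker, LinearMap.sub_apply, sub_eq_zero, eq_comm]
  rfl

theorem mem_ker_subtype_add {A : ℋ →ₗ.[ℂ] ℋ} {x : A.domain} :
    x ∈ LinearMap.ker (A.domain.subtype + A.toFun) ↔ A x = -x := by
  rw [LinearMap.mem_ker, LinearMap.add_apply, add_comm, add_eq_zero_iff_eq_neg]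
  rfl

theorem boundaryForm_add_add {A : ℋ →ₗ.[ℂ] ℋ}
    (a a' : LinearMap.ker (A.domain.subtype - A.toFun))
    (b b' : LinearMap.ker (A.domain.subtype + A.toFun)) :
    A.boundaryForm (a + b) (a' + b') = 2 * ⟪a, a'⟫_ℂ - 2 * ⟪b, b'⟫_ℂ := by
  simp only [boundaryForm_apply, map_add, mem_ker_subtype_sub.1 a.2, mem_ker_subtype_sub.1 a'.2,
    mem_ker_subtype_add.1 b.2, mem_ker_subtype_add.1 b'.2, Submodule.coe_add, inner_add_left,
    inner_add_right, inner_neg_left, inner_neg_right, Submodule.coe_inner]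
  ring

variable [CompleteSpace ℋ]

/-- If membership in a subspace of the domain of a closed operator is a closed condition on the
graph of the form `A x = c • x`, then the subspace is complete. -/
theorem IsClosed.completeSpace_of_mem_iff {A : ℋ →ₗ.[ℂ] ℋ} (hA : A.IsClosed) (c : ℂ)
    {N : Submodule ℂ A.domain} (hN : ∀ x, x ∈ N ↔ A x = c • (x : ℋ)) : CompleteSpace N := by
  have hi : Isometry (fun x : N => ((x : A.domain) : ℋ)) := fun _ _ => rfl
  rw [completeSpace_iff_isComplete_range hi.isUniformInducing]
  have : Set.range (fun x : N => ((x : A.domain) : ℋ))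
      = (fun x : ℋ => (x, c • x)) ⁻¹' (A.graph : Set (ℋ × ℋ)) := by
    ext x
    simp only [Set.mem_range, Set.mem_preimage, SetLike.mem_coe, mem_graph_iff]
    constructor
    · rintro ⟨y, rfl⟩
      exact ⟨y, rfl, (hN y).1 y.2⟩
    · rintro ⟨y, rfl, hy⟩
      exact ⟨⟨y, (hN y).2 hy⟩, rfl⟩
  rw [this]
  exact (hA.preimage (by fun_prop)).isComplete

variable {H₀ : ℋ →ₗ.[ℂ] ℋ}

theorem adjoint_le_adjoint_of_le {T S : ℋ →ₗ.[ℂ] ℋ} (hT : Dense (T.domain : Set ℋ)) (h : T ≤ S) :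
    S.adjoint ≤ T.adjoint := by
  refine IsFormalAdjoint.le_adjoint hT fun x y => ?_
  rw [h.2 (y := ⟨x, h.1 x.2⟩) rfl]
  exact (adjoint_isFormalAdjoint (hT.mono h.1)).symm ⟨x, h.1 x.2⟩ y

/-- The domain of a skew-symmetric operator lies in the radical of the boundary form. -/
theorem boundaryForm_eq_zero_of_mem (hdense : Dense (H₀.domain : Set ℋ))
    (hskew : H₀ ≤ -H₀.adjoint) {x : H₀.adjoint.domain} (hx : (x : ℋ) ∈ H₀.domain)
    (y : H₀.adjoint.domain) :
    H₀.adjoint.boundaryForm x y = 0 ∧ H₀.adjoint.boundaryForm y x = 0 := by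
  have hA : H₀ ⟨x, hx⟩ = -H₀.adjoint x := hskew.2 (x := ⟨x, hx⟩) (y := x) rfl
  have h₁ := (adjoint_isFormalAdjoint hdense) y ⟨x, hx⟩
  have h₂ := (adjoint_isFormalAdjoint hdense).symm ⟨x, hx⟩ y
  rw [hA] at h₁ h₂
  simp only [inner_neg_left, inner_neg_right] at h₁ h₂
  constructor
  · rw [boundaryForm_apply, ← h₂]; ring
  · rw [boundaryForm_apply, h₁]; ring

/-- Von Neumann decomposition of the domain of the adjoint. -/
theorem exists_decomposition (hdense : Dense (H₀.domain : Set ℋ)) (hclosed : H₀.IsClosed)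
    (hskew : H₀ ≤ -H₀.adjoint) (x : H₀.adjoint.domain) :
    ∃ x₀ : H₀.adjoint.domain, (x₀ : ℋ) ∈ H₀.domain ∧
      ∃ a : LinearMap.ker (H₀.adjoint.domain.subtype - H₀.adjoint.toFun),
      ∃ b : LinearMap.ker (H₀.adjoint.domain.subtype + H₀.adjoint.toFun),
        x = x₀ + a + b := by
  let K : Submodule ℂ (WithLp 2 (ℋ × ℋ)) :=
    (-H₀).graph.comap (WithLp.linearEquiv 2 ℂ (ℋ × ℋ)).toLinearMap
  have hK : ∀ p, p ∈ K ↔ ∃ w : H₀.domain, (w : ℋ) = p.fst ∧ -H₀ w = p.snd := fun p =>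
    mem_graph_iff _
  have hKc : _root_.IsClosed (K : Set (WithLp 2 (ℋ × ℋ))) := by
    have : (K : Set (WithLp 2 (ℋ × ℋ)))
        = (fun p => (p.fst, -p.snd)) ⁻¹' (H₀.graph : Set (ℋ × ℋ)) := by
      ext p
      simp only [SetLike.mem_coe, hK, Set.mem_preimage, mem_graph_iff, neg_eq_iff_eq_neg]
    rw [this]
    exact hclosed.preimage (by fun_prop)
  have := hKc.completeSpace_coe
  obtain ⟨p, hp, q, hq, hpq⟩ := K.exists_add_mem_mem_orthogonal
    (WithLp.toLp 2 ((x : ℋ), H₀.adjoint x))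
  obtain ⟨w, hw₁, hw₂⟩ := (hK p).1 hp
  have hwA : (w : ℋ) ∈ H₀.adjoint.domain := hskew.1 w.2
  have hAw : H₀ w = -H₀.adjoint ⟨w, hwA⟩ := hskew.2 (x := w) (y := ⟨w, hwA⟩) rfl
  set z : H₀.adjoint.domain := x - ⟨w, hwA⟩ with hz
  have hq₁ : q.fst = z := by
    have := congrArg WithLp.fst hpq
    simp only [WithLp.add_fst] at this
    rw [hz, Submodule.coe_sub, eq_sub_iff_add_eq', hw₁]
    exact this.symm
  have hq₂ : q.snd = H₀.adjoint z := by
    have := congrArg WithLp.snd hpq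
    simp only [WithLp.add_snd] at this
    rw [hz, map_sub, eq_sub_iff_add_eq', ← neg_neg (H₀.adjoint ⟨w, hwA⟩), ← hAw, hw₂]
    exact this.symm
  have horth : ∀ v : H₀.domain, ⟪(z : ℋ), v⟫_ℂ = ⟪H₀.adjoint z, H₀ v⟫_ℂ := fun v => by
    have h := Submodule.inner_left_of_mem_orthogonal
      ((hK (WithLp.toLp 2 ((v : ℋ), -H₀ v))).2 ⟨v, rfl, rfl⟩) hq
    rw [WithLp.prod_inner_apply] at h
    change ⟪q.fst, (v : ℋ)⟫_ℂ + ⟪q.snd, -H₀ v⟫_ℂ = 0 at h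
    rw [hq₁, hq₂, inner_neg_right] at h
    linear_combination h
  have hAz : H₀.adjoint z ∈ H₀.adjoint.domain := mem_adjoint_domain_of_exists _ ⟨z, horth⟩
  have hAAz : H₀.adjoint ⟨H₀.adjoint z, hAz⟩ = z := adjoint_apply_eq hdense _ horth
  refine ⟨⟨w, hwA⟩, w.2, ⟨(2⁻¹ : ℂ) • (z + ⟨H₀.adjoint z, hAz⟩), ?_⟩,
    ⟨(2⁻¹ : ℂ) • (z - ⟨H₀.adjoint z, hAz⟩), ?_⟩, ?_⟩
  · rw [mem_ker_subtype_sub, map_smul, map_add, hAAz]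
    simp [add_comm]
  · rw [mem_ker_subtype_add, map_smul, map_sub, hAAz]
    simp [← smul_neg]
  · rw [add_assoc, ← sub_eq_iff_eq_add', ← hz]
    module

/-- The canonical boundary system built from the deficiency spaces. -/
theorem exists_deficiency_system (hdense : Dense (H₀.domain : Set ℋ)) (hclosed : H₀.IsClosed)
    (hskew : H₀ ≤ -H₀.adjoint) :
    ∃ F : H₀.adjoint.domain →
        (LinearMap.ker (H₀.adjoint.domain.subtype - H₀.adjoint.toFun)) ×
        (LinearMap.ker (H₀.adjoint.domain.subtype + H₀.adjoint.toFun)),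
      Function.Surjective F ∧ ∀ x y, H₀.adjoint.boundaryForm x y
        = ⟪(F x).1, (F y).1⟫_ℂ - ⟪(F x).2, (F y).2⟫_ℂ := by
  choose x₀ hx₀ a b hab using exists_decomposition hdense hclosed hskew
  have hform : ∀ x y, H₀.adjoint.boundaryForm x y
      = H₀.adjoint.boundaryForm (a x + b x) y := fun x y => by
    conv_lhs => rw [hab x]
    rw [add_assoc, LinearMap.map_add₂, (boundaryForm_eq_zero_of_mem hdense hskew (hx₀ x) y).1,
      zero_add]
  have hform' : ∀ x y, H₀.adjoint.boundaryForm x y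
      = H₀.adjoint.boundaryForm x (a y + b y) := fun x y => by
    conv_lhs => rw [hab y]
    rw [add_assoc, LinearMap.map_add, (boundaryForm_eq_zero_of_mem hdense hskew (hx₀ y) x).2, zero_add]
  refine exists_system_of_two_mul _ (F := fun x => (a x, b x)) ?_ fun x y => ?_
  · rintro ⟨p, q⟩
    refine ⟨p + q, eq_of_forall_inner_sub_inner_eq fun r => ?_⟩
    have h := hform (p + q) (r.1 + r.2)
    rw [boundaryForm_add_add, boundaryForm_add_add] at h
    linear_combination -h / 2
  · rw [hform, hform', boundaryForm_add_add]

/-- A skew-self-adjoint extension gives a Lagrangian subspace for the boundary form. -/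
theorem exists_lagrangian_of_extension (hdense : Dense (H₀.domain : Set ℋ))
    {H : ℋ →ₗ.[ℂ] ℋ} (hH : H₀ ≤ H) (hHskew : H = -H.adjoint) :
    ∃ S : Submodule ℂ H₀.adjoint.domain,
      ∀ y, y ∈ S ↔ ∀ x ∈ S, H₀.adjoint.boundaryForm x y = 0 := by
  have hle := adjoint_le_adjoint_of_le hdense hH
  have hHd : Dense (H.domain : Set ℋ) := hdense.mono hH.1
  have hdom : ∀ x, x ∈ H.domain ↔ x ∈ H.adjoint.domain := fun x => by
    conv_lhs => rw [hHskew]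
    rfl
  have hle' : H ≤ -H.adjoint := hHskew.le
  have hval : ∀ (x : H₀.adjoint.domain) (hx : (x : ℋ) ∈ H.domain),
      H ⟨x, hx⟩ = -H₀.adjoint x := fun x hx => by
    rw [← hle.2 (x := ⟨x, (hdom _).1 hx⟩) rfl]
    exact hle'.2 (x := ⟨x, hx⟩) (y := ⟨x, (hdom _).1 hx⟩) rfl
  refine ⟨H.domain.comap H₀.adjoint.domain.subtype, fun y => ⟨fun hy x hx => ?_, fun h => ?_⟩⟩
  · have h := (adjoint_isFormalAdjoint hHd).symm ⟨x, hx⟩ ⟨y, (hdom _).1 hy⟩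
    rw [hval x hx, hle.2 (x := ⟨y, (hdom _).1 hy⟩) (y := y) rfl, inner_neg_left] at h
    rw [boundaryForm_apply, ← h]
    ring
  · refine (hdom _).2 (mem_adjoint_domain_of_exists _ ⟨H₀.adjoint y, fun x => ?_⟩)
    have hx : (x : ℋ) ∈ H₀.adjoint.domain := hle.1 ((hdom _).1 x.2)
    have h' := h ⟨x, hx⟩ x.2
    rw [boundaryForm_apply] at h'
    have e : H x = -H₀.adjoint ⟨x, hx⟩ := hval ⟨x, hx⟩ x.2
    rw [e, ← inner_conj_symm, ← inner_conj_symm (H₀.adjoint.domain.subtype y), inner_neg_left,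
      Submodule.subtype_apply]
    congr 1
    linear_combination h'

/-- A Lagrangian subspace for the boundary form gives a skew-self-adjoint extension. -/
theorem exists_extension_of_lagrangian (hdense : Dense (H₀.domain : Set ℋ))
    (hskew : H₀ ≤ -H₀.adjoint) {S : Submodule ℂ H₀.adjoint.domain}
    (hS : ∀ y, y ∈ S ↔ ∀ x ∈ S, H₀.adjoint.boundaryForm x y = 0) :
    ∃ H : ℋ →ₗ.[ℂ] ℋ, Dense (H.domain : Set ℋ) ∧ H₀ ≤ H ∧ H = -H.adjoint := by
  let H : ℋ →ₗ.[ℂ] ℋ := (-H₀.adjoint).domRestrict (S.map H₀.adjoint.domain.subtype)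
  have hHdom : ∀ x : H₀.adjoint.domain, (x : ℋ) ∈ H.domain ↔ x ∈ S := fun x => by
    change (x : ℋ) ∈ S.map H₀.adjoint.domain.subtype ⊓ H₀.adjoint.domain ↔ _
    simp
  have hdomA : ∀ x ∈ H.domain, x ∈ H₀.adjoint.domain := fun x hx => hx.2
  have hval : ∀ (x : H.domain), H x = -H₀.adjoint ⟨x, hdomA _ x.2⟩ := fun x => rfl
  have hle : H₀ ≤ H := by
    refine ⟨fun x hx => (hHdom ⟨x, hskew.1 hx⟩).2 ((hS _).2 fun y _ =>
      (boundaryForm_eq_zero_of_mem hdense hskew (x := ⟨x, hskew.1 hx⟩) hx y).2), ?_⟩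
    intro x y hxy
    rw [hval]
    exact hskew.2 hxy
  have hHd : Dense (H.domain : Set ℋ) := hdense.mono hle.1
  have hadj := adjoint_le_adjoint_of_le hdense hle
  refine ⟨H, hHd, hle, ?_⟩
  have hformal : -H ≤ H.adjoint := by
    refine IsFormalAdjoint.le_adjoint hHd fun x y => ?_
    have h := (hS ⟨y, hdomA _ y.2⟩).1 ((hHdom _).1 y.2) ⟨x, hdomA _ x.2⟩ ((hHdom _).1 x.2)
    rw [boundaryForm_apply] at h
    have e : (-H) y = H₀.adjoint ⟨y, hdomA _ y.2⟩ := by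
      rw [neg_apply, ← neg_neg (H₀.adjoint _)]
      exact congrArg Neg.neg (hval y)
    rw [e, hval, inner_neg_left]
    linear_combination -h
  have hle' : H ≤ -H.adjoint := by
    refine ⟨hformal.1, fun x y hxy => ?_⟩
    have := hformal.2 (x := x) (y := y) hxy
    rw [neg_apply] at this
    rw [neg_apply, ← this, neg_neg]
  refine eq_of_le_of_domain_eq hle' (le_antisymm hle'.1 fun y hy => ?_)
  have hy' : y ∈ H.adjoint.domain := hy
  refine (hHdom ⟨y, hadj.1 hy'⟩).2 ((hS _).2 fun x hx => ?_)
  have h := (adjoint_isFormalAdjoint hHd).symm ⟨x, (hHdom x).2 hx⟩ ⟨y, hy'⟩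
  rw [hadj.2 (x := ⟨y, hy'⟩) (y := ⟨y, hadj.1 hy'⟩) rfl, hval, inner_neg_left] at h
  rw [boundaryForm_apply, ← h]
  ring

end LinearPMap

/-- For a skew-symmetric operator `H₀` the following are equivalent:
(i) `H₀` has a skew-self-adjoint extension;
(ii) the deficiency indices of `H₀` coincide, i.e. the Hilbert spaces `ker(1 − H₀*)` and
`ker(1 + H₀*)` have the same Hilbert space dimension (equivalently, they are isometrically
isomorphic);
(iii) there exists a boundary triplet for `H₀`;
(iv) there exists a boundary system `(𝒢₁, 𝒢₂, F)` for `H₀` (standard symmetric and unitary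
forms) with `dim 𝒢₁ = dim 𝒢₂`. -/
theorem stmt_5 {ℋ : Type u}
    [NormedAddCommGroup ℋ] [InnerProductSpace ℂ ℋ] [CompleteSpace ℋ]
    (H₀ : ℋ →ₗ.[ℂ] ℋ)
    (hdense : Dense (H₀.domain : Set ℋ)) (hclosed : H₀.IsClosed)
    (hskew : H₀ ≤ -H₀.adjoint) :
    -- (i) ↔ (ii)
    ((∃ H : ℋ →ₗ.[ℂ] ℋ, Dense (H.domain : Set ℋ) ∧ H₀ ≤ H ∧ H = -H.adjoint) ↔
      Nonempty
        ((LinearMap.ker (H₀.adjoint.domain.subtype - H₀.adjoint.toFun)) ≃ₗᵢ[ℂ]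
          (LinearMap.ker (H₀.adjoint.domain.subtype + H₀.adjoint.toFun)))) ∧
    -- (ii) ↔ (iii)
    ((Nonempty
        ((LinearMap.ker (H₀.adjoint.domain.subtype - H₀.adjoint.toFun)) ≃ₗᵢ[ℂ]
          (LinearMap.ker (H₀.adjoint.domain.subtype + H₀.adjoint.toFun)))) ↔
      (∃ (𝒢 : Type u) (_ : NormedAddCommGroup 𝒢) (_ : InnerProductSpace ℂ 𝒢)
          (_ : CompleteSpace 𝒢) (Γ₁ Γ₂ : H₀.adjoint.domain →ₗ[ℂ] 𝒢),
        Function.Surjective (fun x : H₀.adjoint.domain => (Γ₁ x, Γ₂ x)) ∧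
          ∀ x y : H₀.adjoint.domain,
            ⟪H₀.adjoint x, (y : ℋ)⟫_ℂ + ⟪(x : ℋ), H₀.adjoint y⟫_ℂ
              = ⟪Γ₁ x, Γ₂ y⟫_ℂ + ⟪Γ₂ x, Γ₁ y⟫_ℂ)) ∧
    -- (iii) ↔ (iv)
    ((∃ (𝒢 : Type u) (_ : NormedAddCommGroup 𝒢) (_ : InnerProductSpace ℂ 𝒢)
          (_ : CompleteSpace 𝒢) (Γ₁ Γ₂ : H₀.adjoint.domain →ₗ[ℂ] 𝒢),
        Function.Surjective (fun x : H₀.adjoint.domain => (Γ₁ x, Γ₂ x)) ∧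
          ∀ x y : H₀.adjoint.domain,
            ⟪H₀.adjoint x, (y : ℋ)⟫_ℂ + ⟪(x : ℋ), H₀.adjoint y⟫_ℂ
              = ⟪Γ₁ x, Γ₂ y⟫_ℂ + ⟪Γ₂ x, Γ₁ y⟫_ℂ) ↔
      (∃ (𝒢₁ : Type u) (_ : NormedAddCommGroup 𝒢₁) (_ : InnerProductSpace ℂ 𝒢₁)
          (_ : CompleteSpace 𝒢₁) (𝒢₂ : Type u) (_ : NormedAddCommGroup 𝒢₂)
          (_ : InnerProductSpace ℂ 𝒢₂) (_ : CompleteSpace 𝒢₂),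
        Nonempty (𝒢₁ ≃ₗᵢ[ℂ] 𝒢₂) ∧
          ∃ F : H₀.adjoint.domain → 𝒢₁ × 𝒢₂,
            Function.Surjective F ∧
              ∀ x y : H₀.adjoint.domain,
                ⟪(x : ℋ), H₀.adjoint y⟫_ℂ + ⟪H₀.adjoint x, (y : ℋ)⟫_ℂ
                  = ⟪(F x).1, (F y).1⟫_ℂ - ⟪(F x).2, (F y).2⟫_ℂ)) := by
  have hA := LinearPMap.adjoint_isClosed hdense
  have := hA.completeSpace_of_mem_iff 1
    (N := LinearMap.ker (H₀.adjoint.domain.subtype - H₀.adjoint.toFun))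
    fun x => by rw [LinearPMap.mem_ker_subtype_sub, one_smul]
  have := hA.completeSpace_of_mem_iff (-1)
    (N := LinearMap.ker (H₀.adjoint.domain.subtype + H₀.adjoint.toFun))
    fun x => by rw [LinearPMap.mem_ker_subtype_add, neg_one_smul]
  obtain ⟨F, hF, hFB⟩ := LinearPMap.exists_deficiency_system hdense hclosed hskew
  refine ⟨⟨?_, ?_⟩, ⟨?_, ?_⟩, ⟨?_, ?_⟩⟩
  · rintro ⟨H, -, hH, hHskew⟩
    obtain ⟨S, hS⟩ := LinearPMap.exists_lagrangian_of_extension hdense hH hHskew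
    exact nonempty_linearIsometryEquiv_of_form _ hF hFB S hS
  · rintro ⟨U⟩
    obtain ⟨Γ₁, Γ₂, hΓ, hB⟩ := exists_triplet_of_system _ hF hFB U
    exact LinearPMap.exists_extension_of_lagrangian hdense hskew
      (mem_ker_iff_of_triplet _ hΓ hB)
  · rintro ⟨U⟩
    exact ⟨_, _, _, inferInstance, exists_triplet_of_system _ hF hFB U⟩
  · rintro ⟨𝒢, _, _, _, Γ₁, Γ₂, hΓ, hB⟩
    exact nonempty_linearIsometryEquiv_of_form _ hF hFB _
      (mem_ker_iff_of_triplet H₀.adjoint.boundaryForm hΓ hB)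
  · rintro ⟨𝒢, _, _, _, Γ₁, Γ₂, hΓ, hB⟩
    obtain ⟨F', hF', hB'⟩ := exists_system_of_triplet H₀.adjoint.boundaryForm hΓ hB
    exact ⟨𝒢, _, _, inferInstance, 𝒢, _, _, inferInstance, ⟨LinearIsometryEquiv.refl ℂ 𝒢⟩,
      F', hF', fun x y => (add_comm _ _).trans (hB' x y)⟩
  · rintro ⟨𝒢₁, _, _, _, 𝒢₂, _, _, _, ⟨U⟩, F', hF', hB'⟩
    exact ⟨𝒢₁, _, _, inferInstance, exists_triplet_of_system H₀.adjoint.boundaryForm hF'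
      (fun x y => (add_comm _ _).trans (hB' x y)) U⟩
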